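/- Theorem 3.3 (recursion for the partition function at the reflection s_n): Assume σ(n) ∈ [n]. Let s_n ∈ B_n be defined by s_n(n) = n̄ and s_n(j) = j for j ∈ {1,…,n−1}, and let s_n·x := (x_1,…,x_{n−1},x_n^{−1}). Then q·s^{−2L}·((1−s x_n)/(s−x_n))^L · f_μ^{σ s_n}(x) = ((√q − ν t x_n)(√q + ν^{−1} x_n)/(t(1−x_n²))) · [ ((1−q x_n²)/(x_n²−q)) · ((s−x_n)/(1−s x_n))^L · f_μ^σ(s_n·x) − ((1−s x_n)/(s−x_n))^L · f_μ^σ(x) ] + ((1−s x_n)/(s−x_n))^L · f_μ^σ(x), provided all denominators appearing are nonzero. -/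

import Mathlib

open scoped BigOperators

/-- The set of colors `{0} ∪ [±n]`, encoded as `Fin (2*n+1)`:
index `i < n` is the positive color `i+1`, index `n` is the color `0`,
and index `k > n` is the negative color `\overline{2*n+1-k}`.
The order on `Fin (2*n+1)` is exactly the color order
`1 < ⋯ < n < 0 < n̄ < ⋯ < 1̄`. -/
abbrev Col (n : ℕ) := Fin (2*n+1)

/-- The color `0` (identified with the `+` spin). -/
def mid (n : ℕ) : Col n := ⟨n, by omega⟩

/-- The bar involution `i ↦ ī` on colors (fixing `0`). -/
def barC (n : ℕ) (c : Col n) : Col n := ⟨2*n - c.val, by omega⟩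

/-- The positive color `i+1` attached to `i : Fin n`. -/
def posC (n : ℕ) (i : Fin n) : Col n := ⟨i.val, by have := i.isLt; omega⟩

/-- Vectors `I ∈ ℕ^{2n}` indexed by the colors `[±n]` (the entry at the
color `0` is irrelevant/always `0`). -/
abbrev Vec (n : ℕ) := Col n → ℕ

/-- `e_j`: the standard basis vector for `j ∈ [±n]`, and `e_0 = 0`. -/
def eV (n : ℕ) (c : Col n) : Vec n := fun k => if c ≠ mid n ∧ k = c then 1 else 0

/-- `I_{[1,n]}`. -/
def sLo (n : ℕ) (I : Vec n) : ℕ := ∑ k ∈ Finset.univ.filter (fun k : Col n => k < mid n), I k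
/-- `I_{[n̄,1̄]}`. -/
def sHi (n : ℕ) (I : Vec n) : ℕ := ∑ k ∈ Finset.univ.filter (fun k : Col n => mid n < k), I k
/-- `I_{≤ l}`. -/
def sLe (n : ℕ) (I : Vec n) (l : Col n) : ℕ := ∑ k ∈ Finset.univ.filter (fun k : Col n => k ≤ l), I k
/-- `I_{< l}`. -/
def sLt (n : ℕ) (I : Vec n) (l : Col n) : ℕ := ∑ k ∈ Finset.univ.filter (fun k : Col n => k < l), I k
/-- `I_{> l}`. -/
def sGt (n : ℕ) (I : Vec n) (l : Col n) : ℕ := ∑ k ∈ Finset.univ.filter (fun k : Col n => l < k), I k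
/-- `I_{≥ l}`. -/
def sGe (n : ℕ) (I : Vec n) (l : Col n) : ℕ := ∑ k ∈ Finset.univ.filter (fun k : Col n => l ≤ k), I k

/-- The Boltzmann weight `L_x(I, j, K, ℓ)` of a Γ vertex (Table 2.1). -/
noncomputable def LW (n : ℕ) (q s x : ℂ) (I : Vec n) (j : Col n) (K : Vec n) (l : Col n) : ℂ :=
  if ∀ k, I k + eV n j k = K k + eV n l k then
    if j = l then
      if l = mid n then (q ^ (-(sLo n I : ℤ)) - s * x * q ^ (sHi n I : ℤ)) / (1 - s * x)
      else if l < mid n then (s * q ^ (I l : ℤ) - x) * q ^ (-(sLe n I l : ℤ)) / (s * (1 - s * x))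
      else s * (s * q ^ (I l : ℤ) - x) * q ^ (sGt n I l : ℤ) / (1 - s * x)
    else if j < l then
      if l = mid n then (x * q ^ (-(sLo n I : ℤ)) - s ^ 2 * x * q ^ (sHi n I : ℤ)) / (s * (1 - s * x))
      else if l < mid n then -x * (1 - q ^ (I l : ℤ)) * q ^ (-(sLe n I l : ℤ)) / (s * (1 - s * x))
      else -(s * x) * (1 - q ^ (I l : ℤ)) * q ^ (sGt n I l : ℤ) / (1 - s * x)
    else
      if l = mid n then (q ^ (-(sLo n I : ℤ)) - s ^ 2 * q ^ (sHi n I : ℤ)) / (1 - s * x)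
      else if l < mid n then -(1 - q ^ (I l : ℤ)) * q ^ (-(sLe n I l : ℤ)) / (1 - s * x)
      else -(s ^ 2) * (1 - q ^ (I l : ℤ)) * q ^ (sGt n I l : ℤ) / (1 - s * x)
  else 0

/-- The Boltzmann weight `M_x(I, j, K, ℓ)` of a Δ vertex (Table 2.2). -/
noncomputable def MW (n : ℕ) (q s x : ℂ) (I : Vec n) (j : Col n) (K : Vec n) (l : Col n) : ℂ :=
  if ∀ k, I k + eV n j k = K k + eV n l k then
    if j = l then
      if l = mid n then (q ^ (-(sHi n I : ℤ)) - s * x * q ^ (sLo n I : ℤ)) / (1 - s * x)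
      else if l < mid n then s * (s * q ^ (I l : ℤ) - x) * q ^ (sLt n I l : ℤ) / (1 - s * x)
      else (1 - s⁻¹ * x * q ^ (-(I l : ℤ))) * q ^ (-(sGt n I l : ℤ)) / (1 - s * x)
    else if j < l then
      if l = mid n then (q ^ (-(sHi n I : ℤ)) - s ^ 2 * q ^ (sLo n I : ℤ)) / (1 - s * x)
      else if l < mid n then -(s ^ 2) * (1 - q ^ (I l : ℤ)) * q ^ (sLt n I l : ℤ) / (1 - s * x)
      else -(1 - q ^ (I l : ℤ)) * q ^ (-(sGe n I l : ℤ)) / (1 - s * x)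
    else
      if l = mid n then x * (s⁻¹ * q ^ (-(sHi n I : ℤ)) - s * q ^ (sLo n I : ℤ)) / (1 - s * x)
      else if l < mid n then -(s * x) * (1 - q ^ (I l : ℤ)) * q ^ (sLt n I l : ℤ) / (1 - s * x)
      else -(s⁻¹ * x) * (1 - q ^ (I l : ℤ)) * q ^ (-(sGe n I l : ℤ)) / (1 - s * x)
  else 0

/-- `φ(z) = (1-z²)/((1-νtz)(1+ν⁻¹z))`. -/
noncomputable def phiF (ν t z : ℂ) : ℂ := (1 - z ^ 2) / ((1 - ν * t * z) * (1 + ν⁻¹ * z))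

/-- The cap vertex Boltzmann weight `Cap_x(ε → ε')` (Figure 2.3), where `ε` is
the incoming bottom color and `ε'` the outgoing top color, and `qh` denotes the
fixed branch of `q^{-1/2}`. -/
noncomputable def capW (n : ℕ) (ν t qh x : ℂ) (ε ε' : Col n) : ℂ :=
  if ε = mid n ∧ ε' = mid n then 1
  else if ε < mid n ∧ ε' = barC n ε then t * phiF ν t (qh * x⁻¹)
  else if ε < mid n ∧ ε' = ε then 1 - t * phiF ν t (qh * x⁻¹)
  else if mid n < ε ∧ ε' = barC n ε then phiF ν t (qh * x⁻¹)
  else if mid n < ε ∧ ε' = ε then 1 - phiF ν t (qh * x⁻¹)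
  else 0

/-- A state of the model on the `2n × L` lattice: the first component assigns a
color to each horizontal edge (row `r : Fin (2n)`, 0-indexed top to bottom, and
horizontal position `p : Fin (L+1)`, with `p = 0` the right boundary and
`p = L` the left boundary; the vertex in the paper's column `c+1` of row `r+1`
lies between positions `c` (east) and `c+1` (west)); the second component
assigns a vector in `ℕ^{2n}` to each vertical edge (level `v : Fin (2n+1)`,
with `v = 0` the top boundary and `v = 2n` the bottom boundary, and column
`c : Fin L`, 0-indexed right to left). -/
abbrev St (n L : ℕ) := (Fin (2*n) × Fin (L+1) → Col n) × (Fin (2*n+1) × Fin L → Vec n)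

/-- The vector assigned at the top of column `c` (the paper's column `c+1`):
`∑_{i=1}^n (1_{μ_i = c+1} e_i + 1_{μ_i = -(c+1)} e_{ī})`. -/
def topV (n L : ℕ) (μ : Fin n → ℤ) (c : Fin L) : Vec n := fun k =>
  ∑ i : Fin n,
    ((if μ i = (c.val : ℤ) + 1 ∧ k = posC n i then 1 else 0) +
     (if μ i = -((c.val : ℤ) + 1) ∧ k = barC n (posC n i) then 1 else 0))

/-- The boundary conditions of the model with data `(σ, μ)`: on the left, the
paper's row `2i-1` (a Δ row, 0-indexed row `2i-2`, even) carries the color `0`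
and the paper's row `2i` (a Γ row, 0-indexed row `2i-1`, odd) carries the color
`σ(i)`; at the bottom every vertical edge carries the zero vector; at the top
the vertical edge in column `c` carries `topV μ c`. -/
def BC (n L : ℕ) (σ : Equiv.Perm (Col n)) (μ : Fin n → ℤ) (st : St n L) : Prop :=
  (∀ r : Fin (2*n), st.1 (r, Fin.last L) =
      if r.val % 2 = 0 then mid n
      else σ (posC n ⟨r.val / 2, by have := r.isLt; omega⟩)) ∧
  (∀ c : Fin L, st.2 (0, c) = topV n L μ c) ∧
  (∀ c : Fin L, st.2 (Fin.last (2*n), c) = fun _ => 0)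

/-- The Boltzmann weight of a state: the product of the weights of all the
Γ, Δ and cap vertices.  Even 0-indexed rows (the paper's odd rows `2i-1`) are
rows of Δ vertices and odd 0-indexed rows (the paper's even rows `2i`) are rows
of Γ vertices, both with spectral parameter `x i`; the cap with spectral
parameter `x i` joins the right end of the paper's row `2i` (incoming, bottom)
to the right end of the paper's row `2i-1` (outgoing, top).
Here `qh` denotes the fixed branch of `q^{-1/2}`. -/
noncomputable def stWt (n L : ℕ) (q s ν t qh : ℂ) (x : Fin n → ℂ) (st : St n L) : ℂ :=
  (∏ r : Fin (2*n), ∏ c : Fin L,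
    if r.val % 2 = 0 then
      MW n q s (x ⟨r.val / 2, by have := r.isLt; omega⟩)
        (st.2 (r.succ, c)) (st.1 (r, c.castSucc)) (st.2 (r.castSucc, c)) (st.1 (r, c.succ))
    else
      LW n q s (x ⟨r.val / 2, by have := r.isLt; omega⟩)
        (st.2 (r.succ, c)) (st.1 (r, c.succ)) (st.2 (r.castSucc, c)) (st.1 (r, c.castSucc)))
  * ∏ i : Fin n,
      capW n ν t qh (x i)
        (st.1 (⟨2 * i.val + 1, by have := i.isLt; omega⟩, 0))
        (st.1 (⟨2 * i.val, by have := i.isLt; omega⟩, 0))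

/-- The partition function `f_μ^σ(x)` of the colored stochastic vertex model
with U-turn boundary: the sum of the Boltzmann weights of all states satisfying
the boundary conditions (the weight of a non-admissible state is `0`, and only
finitely many states have nonzero weight, so this is a finite sum over the
admissible states). -/
noncomputable def pf (n L : ℕ) (q s ν t qh : ℂ) (x : Fin n → ℂ)
    (σ : Equiv.Perm (Col n)) (μ : Fin n → ℤ) : ℂ :=
  ∑ᶠ st ∈ {st : St n L | BC n L σ μ st}, stWt n L q s ν t qh x st

/-- The element `s_i ∈ B_n` (for paper indices `i, i+1`, here 0-indexed `i, i'`
with `i' = i+1`), viewed as the permutation of the colors swapping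
`i ↔ i+1` and `ī ↔ \overline{i+1}`. -/
def siB (n : ℕ) (i i' : Fin n) : Equiv.Perm (Col n) :=
  (Equiv.swap (posC n i) (posC n i')).trans
    (Equiv.swap (barC n (posC n i)) (barC n (posC n i')))

/-- The color `n` (the paper's largest positive color). -/
def lastCol (n : ℕ) : Col n := ⟨n - 1, by omega⟩

/-- The element `s_n ∈ B_n` with `s_n(n) = n̄` and `s_n(j) = j` for `j < n`,
viewed as the permutation of the colors swapping `n ↔ n̄`. -/
def snB (n : ℕ) : Equiv.Perm (Col n) :=
  Equiv.swap (lastCol n) (barC n (lastCol n))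


lemma phi_one (r ν t x : ℂ) (hr : r ≠ 0) (hν : ν ≠ 0) (hx : x ≠ 0) :
    phiF ν t (r⁻¹ * x⁻¹) = ν * (r^2*x^2-1) / ((r*x-ν*t)*(ν*r*x+1)) := by
  have e1 : (1 - ν * t * (r⁻¹ * x⁻¹)) = (r*x-ν*t) / (r*x) := by field_simp
  have e2 : (1 + ν⁻¹ * (r⁻¹ * x⁻¹)) = (ν*r*x+1) / (ν*r*x) := by field_simp
  have e3 : (1 - (r⁻¹ * x⁻¹)^2) = (r^2*x^2-1) / (r*x)^2 := by field_simp
  unfold phiF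
  rw [e1, e2, e3, div_mul_div_comm, div_div_div_eq,
    show (r*x)*(ν*r*x) = ν * (r*x)^2 by ring,
    show (r^2*x^2-1) * (ν * (r*x)^2) = (r*x)^2 * (ν * (r^2*x^2-1)) by ring,
    mul_div_mul_left _ _ (by positivity)]

lemma phi_two (r ν t x : ℂ) (hr : r ≠ 0) (hν : ν ≠ 0) :
    phiF ν t (r⁻¹ * x) = ν * (r^2-x^2) / ((r-ν*t*x)*(ν*r+x)) := by
  have e1 : (1 - ν * t * (r⁻¹ * x)) = (r-ν*t*x) / r := by field_simp
  have e2 : (1 + ν⁻¹ * (r⁻¹ * x)) = (ν*r+x) / (ν*r) := by field_simp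
  have e3 : (1 - (r⁻¹ * x)^2) = (r^2-x^2) / r^2 := by field_simp
  unfold phiF
  rw [e1, e2, e3, div_mul_div_comm, div_div_div_eq,
    show r*(ν*r) = ν * r^2 by ring,
    show (r^2-x^2) * (ν * r^2) = r^2 * (ν * (r^2-x^2)) by ring,
    mul_div_mul_left _ _ (by positivity)]

/-- Final scalar identity, output color `c`. -/
lemma alg_pos (r s ν t x a : ℂ) (hr : r ≠ 0) (hs : s ≠ 0) (hν : ν ≠ 0) (ht : t ≠ 0)
    (hx : x ≠ 0) (ha : a ≠ 0) (h1 : r*x-ν*t ≠ 0) (h2 : ν*r*x+1 ≠ 0) (h3 : r-ν*t*x ≠ 0)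
    (h4 : ν*r+x ≠ 0) (h5 : x^2-r^2 ≠ 0) (h6 : 1-x^2 ≠ 0) (h7 : s-x ≠ 0) (h8 : 1-s*x ≠ 0) :
    r^2 * s⁻¹ * ((1-s^2)/(1-s*x)) * a * (ν * (r^2*x^2-1) / ((r*x-ν*t)*(ν*r*x+1)))
    = ((r - ν * t * x) * (ν*r + x) / (ν * t * (1 - x ^ 2)))
          * (((1 - r^2 * x ^ 2) / (x ^ 2 - r^2)) *
            (s⁻¹ * (x*(1-s^2)/(x-s)) * (a⁻¹ * (1 - t * (ν * (r^2-x^2) / ((r-ν*t*x)*(ν*r+x))))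
              - (1-r^2)/(1-x^2) * (a⁻¹ - a))
              + (s-x)/(1-s*x) * a * ((1-s^2)/(s*(x-s))) * ((x-s*r^2)/(x-s)))
          - (s⁻¹ * ((1-s^2)/(1-s*x)) * (a * (1 - t * (ν * (r^2*x^2-1) / ((r*x-ν*t)*(ν*r*x+1))))
              + x^2*(1-r^2)/(1-x^2) * (a - a⁻¹))
              + (1-s*x)/(s-x) * a⁻¹ * (x*(1-s^2)/(s*(1-s*x))) * ((1-s*x*r^2)/(1-s*x))))
       + (s⁻¹ * ((1-s^2)/(1-s*x)) * (a * (1 - t * (ν * (r^2*x^2-1) / ((r*x-ν*t)*(ν*r*x+1))))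
              + x^2*(1-r^2)/(1-x^2) * (a - a⁻¹))
              + (1-s*x)/(s-x) * a⁻¹ * (x*(1-s^2)/(s*(1-s*x))) * ((1-s*x*r^2)/(1-s*x))) := by
  rw [show x - s = -(s-x) by ring, show r^2-x^2 = -(x^2-r^2) by ring]
  obtain ⟨D1, e1⟩ : ∃ D, D = r*x-ν*t := ⟨_, rfl⟩
  obtain ⟨D2, e2⟩ : ∃ D, D = ν*r*x+1 := ⟨_, rfl⟩
  obtain ⟨D3, e3⟩ : ∃ D, D = r-ν*t*x := ⟨_, rfl⟩
  obtain ⟨D4, e4⟩ : ∃ D, D = ν*r+x := ⟨_, rfl⟩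
  obtain ⟨D5, e5⟩ : ∃ D, D = x^2-r^2 := ⟨_, rfl⟩
  obtain ⟨D6, e6⟩ : ∃ D, D = 1-x^2 := ⟨_, rfl⟩
  obtain ⟨D7, e7⟩ : ∃ D, D = s-x := ⟨_, rfl⟩
  obtain ⟨D8, e8⟩ : ∃ D, D = 1-s*x := ⟨_, rfl⟩
  rw [← e1] at h1 ⊢; rw [← e2] at h2 ⊢; rw [← e3] at h3 ⊢; rw [← e4] at h4 ⊢
  rw [← e5] at h5 ⊢; rw [← e6] at h6 ⊢; rw [← e7] at h7 ⊢; rw [← e8] at h8 ⊢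
  field_simp
  subst e1 e2 e3 e4 e5 e6 e7 e8
  ring

/-- Final scalar identity, output color `c̄`. -/
lemma alg_neg (r s ν t x a : ℂ) (hr : r ≠ 0) (hs : s ≠ 0) (hν : ν ≠ 0) (ht : t ≠ 0)
    (hx : x ≠ 0) (ha : a ≠ 0) (h1 : r*x-ν*t ≠ 0) (h2 : ν*r*x+1 ≠ 0) (h3 : r-ν*t*x ≠ 0)
    (h4 : ν*r+x ≠ 0) (h5 : x^2-r^2 ≠ 0) (h6 : 1-x^2 ≠ 0) (h7 : s-x ≠ 0) (h8 : 1-s*x ≠ 0) :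
    r^2 * (s⁻¹ * (x*(s⁻¹-s)/(1-s*x)) * (a * (1 - (ν * (r^2*x^2-1) / ((r*x-ν*t)*(ν*r*x+1))))
              + (r^2)⁻¹*(1-r^2)/(1-x^2) * (a - a⁻¹))
              + (s^2)⁻¹ * ((1-s*x)/(s-x)) * a⁻¹ * ((1-s^2)/(1-s*x)) * (((r^2)⁻¹-s*x)/(1-s*x)))
    = ((r - ν * t * x) * (ν*r + x) / (ν * t * (1 - x ^ 2)))
          * (((1 - r^2 * x ^ 2) / (x ^ 2 - r^2)) *
            (s⁻¹ * ((s⁻¹-s)/(x-s)) * (a⁻¹ * (t * (ν * (r^2-x^2) / ((r-ν*t*x)*(ν*r+x))))))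
          - (s⁻¹ * (x*(s⁻¹-s)/(1-s*x)) * (a * (t * (ν * (r^2*x^2-1) / ((r*x-ν*t)*(ν*r*x+1)))))))
       + (s⁻¹ * (x*(s⁻¹-s)/(1-s*x)) * (a * (t * (ν * (r^2*x^2-1) / ((r*x-ν*t)*(ν*r*x+1)))))) := by
  rw [show x - s = -(s-x) by ring, show r^2-x^2 = -(x^2-r^2) by ring]
  obtain ⟨D1, e1⟩ : ∃ D, D = r*x-ν*t := ⟨_, rfl⟩
  obtain ⟨D2, e2⟩ : ∃ D, D = ν*r*x+1 := ⟨_, rfl⟩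
  obtain ⟨D3, e3⟩ : ∃ D, D = r-ν*t*x := ⟨_, rfl⟩
  obtain ⟨D4, e4⟩ : ∃ D, D = ν*r+x := ⟨_, rfl⟩
  obtain ⟨D5, e5⟩ : ∃ D, D = x^2-r^2 := ⟨_, rfl⟩
  obtain ⟨D6, e6⟩ : ∃ D, D = 1-x^2 := ⟨_, rfl⟩
  obtain ⟨D7, e7⟩ : ∃ D, D = s-x := ⟨_, rfl⟩
  obtain ⟨D8, e8⟩ : ∃ D, D = 1-s*x := ⟨_, rfl⟩
  rw [← e1] at h1 ⊢; rw [← e2] at h2 ⊢; rw [← e3] at h3 ⊢; rw [← e4] at h4 ⊢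
  rw [← e5] at h5 ⊢; rw [← e6] at h6 ⊢; rw [← e7] at h7 ⊢; rw [← e8] at h8 ⊢
  field_simp
  subst e1 e2 e3 e4 e5 e6 e7 e8
  ring

noncomputable def uL (n : ℕ) (s x : ℂ) (c : Col n) : ℂ :=
  if c = mid n then 1 else if c < mid n then (s-x)/(s*(1-s*x)) else s*(s-x)/(1-s*x)
noncomputable def dL (n : ℕ) (s x : ℂ) (c : Col n) : ℂ :=
  if c < mid n then x*(1-s^2)/(s*(1-s*x)) else (1-s^2)/(1-s*x)
noncomputable def vM (n : ℕ) (s x : ℂ) (c : Col n) : ℂ :=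
  if c = mid n then 1 else if c < mid n then s*(s-x)/(1-s*x) else (1-s⁻¹*x)/(1-s*x)
noncomputable def ddM (n : ℕ) (s x : ℂ) (c : Col n) : ℂ :=
  if c < mid n then (1-s^2)/(1-s*x) else x*(s⁻¹-s)/(1-s*x)
noncomputable def stayM (n : ℕ) (q s x : ℂ) (c : Col n) : ℂ :=
  if c < mid n then (1-s*x*q)/(1-s*x) else (q⁻¹-s*x)/(1-s*x)
noncomputable def pM (n : ℕ) (q s x : ℂ) (c : Col n) : ℂ :=
  if c < mid n then -(s*x)*(1-q)/(1-s*x) else -(1-q)*q⁻¹/(1-s*x)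

lemma eV_mid (n : ℕ) : eV n (mid n) = 0 := by
  funext k; simp [eV]

lemma eV_self (n : ℕ) (c : Col n) (hc : c ≠ mid n) : eV n c c = 1 := by
  simp [eV, hc]

lemma eV_ne_zero (n : ℕ) (c : Col n) (hc : c ≠ mid n) : eV n c ≠ 0 := by
  intro h
  have := congrFun h c
  simp [eV, hc] at this

lemma eV_inj (n : ℕ) (c d : Col n) (hc : c ≠ mid n) (h : eV n c = eV n d) : c = d := by
  have := congrFun h c
  simp only [eV, hc, ne_eq, not_false_eq_true, true_and, if_true] at this
  by_contra hcd
  simp [hcd] at this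

lemma sum_eV (n : ℕ) (P : Col n → Prop) [DecidablePred P] (c : Col n) :
    ∑ k ∈ Finset.univ.filter P, eV n c k = if c ≠ mid n ∧ P c then 1 else 0 := by
  by_cases hc : c = mid n
  · simp [eV, hc]
  · simp [eV, hc, Finset.sum_ite_eq']

lemma LW_zero (n : ℕ) (q s x : ℂ) (h8 : 1 - s*x ≠ 0) (j l : Col n) (K : Vec n) :
    LW n q s x 0 j K l = if j = l then (if K = 0 then uL n s x j else 0)
      else if l = mid n then (if K = eV n j then dL n s x j else 0) else 0 := by
  unfold LW
  by_cases hjl : j = l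
  · subst hjl
    have hc : (∀ k, (0 : Vec n) k + eV n j k = K k + eV n j k) ↔ K = 0 := by
      constructor
      · intro h; funext k; have := h k; simp at this; simpa using this
      · rintro rfl k; rfl
    by_cases hK : K = 0
    · rw [if_pos (hc.2 hK)]
      simp [hK, uL, sLo, sHi, sLe, sGt, h8]
    · rw [if_neg (fun h => hK (hc.1 h))]
      simp [hK]
  · simp only [hjl, if_false]
    by_cases hl : l = mid n
    · subst hl
      have hc : (∀ k, (0 : Vec n) k + eV n j k = K k + eV n (mid n) k) ↔ K = eV n j := by
        rw [eV_mid]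
        constructor
        · intro h; funext k; have := h k; simp at this; exact this.symm
        · rintro rfl k; simp
      by_cases hK : K = eV n j
      · rw [if_pos (hc.2 hK)]
        simp only [if_true, hK, dL, sLo, sHi]
        simp
        split_ifs <;> ring
      · rw [if_neg (fun h => hK (hc.1 h))]
        simp [hK]
    · simp [hl]

lemma MW_zero (n : ℕ) (q s x : ℂ) (h8 : 1 - s*x ≠ 0) (j l : Col n) (K : Vec n) :
    MW n q s x 0 j K l = if j = l then (if K = 0 then vM n s x j else 0)
      else if l = mid n then (if K = eV n j then ddM n s x j else 0) else 0 := by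
  unfold MW
  by_cases hjl : j = l
  · subst hjl
    have hc : (∀ k, (0 : Vec n) k + eV n j k = K k + eV n j k) ↔ K = 0 := by
      constructor
      · intro h; funext k; have := h k; simp at this; simpa using this
      · rintro rfl k; rfl
    by_cases hK : K = 0
    · rw [if_pos (hc.2 hK)]
      simp [hK, vM, sLo, sHi, sLt, sGt, h8]
    · rw [if_neg (fun h => hK (hc.1 h))]
      simp [hK]
  · simp only [hjl, if_false]
    by_cases hl : l = mid n
    · subst hl
      have hc : (∀ k, (0 : Vec n) k + eV n j k = K k + eV n (mid n) k) ↔ K = eV n j := by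
        rw [eV_mid]
        constructor
        · intro h; funext k; have := h k; simp at this; exact this.symm
        · rintro rfl k; simp
      by_cases hK : K = eV n j
      · rw [if_pos (hc.2 hK)]
        simp only [if_true, hK, ddM, sLo, sHi]
        simp
      · rw [if_neg (fun h => hK (hc.1 h))]
        simp [hK]
    · simp [hl]

lemma MW_one (n : ℕ) (q s x : ℂ) (c l : Col n) (hc : c ≠ mid n) (K : Vec n) :
    MW n q s x (eV n c) (mid n) K l = if l = mid n then (if K = eV n c then stayM n q s x c else 0)
      else if l = c then (if K = 0 then pM n q s x c else 0) else 0 := by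
  unfold MW
  by_cases hl : l = mid n
  · subst hl
    have hK' : (∀ k, eV n c k + eV n (mid n) k = K k + eV n (mid n) k) ↔ K = eV n c := by
      constructor
      · intro h; funext k; have := h k; omega
      · rintro rfl k; rfl
    by_cases hK : K = eV n c
    · rw [if_pos (hK'.2 hK)]
      simp only [if_true, hK, sLo, sHi, sum_eV, stayM]
      rcases lt_trichotomy c (mid n) with h | h | h
      · simp [h, h.ne, h.not_gt]
      · exact absurd h hc
      · simp [h, h.ne', h.not_gt]
    · rw [if_neg (fun h => hK (hK'.1 h))]
      simp [hK]
  · simp only [hl, if_false]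
    by_cases hlc : l = c
    · subst hlc
      have hK' : (∀ k, eV n l k + eV n (mid n) k = K k + eV n l k) ↔ K = 0 := by
        rw [eV_mid]
        constructor
        · intro h; funext k; have := h k; simp at this; simpa using this
        · rintro rfl k; simp
      by_cases hK : K = 0
      · rw [if_pos (hK'.2 hK)]
        simp only [if_true, hK, sLt, sGe, sum_eV, pM, eV_self n l hc]
        rcases lt_trichotomy l (mid n) with h | h | h
        · simp [h, h.ne', h.not_gt]
        · exact absurd h hc
        · simp [h, h.ne, h.ne', h.not_gt]
      · rw [if_neg (fun h => hK (hK'.1 h))]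
        simp [hK]
    · rw [if_neg]
      · simp [hlc]
      · intro h
        have := h l
        rw [eV_mid, eV_self n l hl] at this
        simp [eV, hlc] at this

/-- Transfer weight through one column of the bottom double row. -/
noncomputable def Tw (n : ℕ) (q s x : ℂ) (V : Vec n) (p p' : Col n × Col n) : ℂ :=
  LW n q s x 0 p'.1 (fun k => V k + eV n p'.2 k - eV n p.2 k) p.1 *
    MW n q s x (fun k => V k + eV n p'.2 k - eV n p.2 k) p.2 V p'.2

lemma MW_cons (n : ℕ) (q s x : ℂ) (I K : Vec n) (j l : Col n)
    (h : MW n q s x I j K l ≠ 0) : ∀ k, I k + eV n j k = K k + eV n l k := by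
  by_contra hc
  exact h (by unfold MW; rw [if_neg hc])

lemma LW_cons (n : ℕ) (q s x : ℂ) (I K : Vec n) (j l : Col n)
    (h : LW n q s x I j K l ≠ 0) : ∀ k, I k + eV n j k = K k + eV n l k := by
  by_contra hc
  exact h (by unfold LW; rw [if_neg hc])

lemma Tw_aux (n : ℕ) (q s x : ℂ) (I V : Vec n) (b b' : Col n) (z : ℂ) :
    (if (fun k => V k + eV n b' k - eV n b k) = I then z else 0) *
      MW n q s x (fun k => V k + eV n b' k - eV n b k) b V b' = z * MW n q s x I b V b' := by
  split_ifs with h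
  · rw [h]
  · by_cases hM : MW n q s x I b V b' = 0
    · rw [hM]; simp
    · exfalso
      apply h
      funext k
      have := MW_cons n q s x _ _ _ _ hM k
      omega

lemma Tw_eq (n : ℕ) (q s x : ℂ) (h8 : 1 - s*x ≠ 0) (V : Vec n) (p p' : Col n × Col n) :
    Tw n q s x V p p' = if p'.1 = p.1 then uL n s x p'.1 * MW n q s x 0 p.2 V p'.2
      else if p.1 = mid n then dL n s x p'.1 * MW n q s x (eV n p'.1) p.2 V p'.2 else 0 := by
  unfold Tw
  rw [LW_zero n q s x h8]
  by_cases h1 : p'.1 = p.1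
  · rw [if_pos h1, if_pos h1, Tw_aux]
  · rw [if_neg h1, if_neg h1]
    by_cases h2 : p.1 = mid n
    · rw [if_pos h2, if_pos h2, Tw_aux]
    · rw [if_neg h2, if_neg h2, zero_mul]

noncomputable def psi (n : ℕ) (q s x : ℂ) (cap : Col n × Col n → ℂ) (V : ℕ → Vec n) :
    ℕ → Col n × Col n → ℂ
  | 0, p => cap p
  | k+1, p' => ∑ p, psi n q s x cap V k p * Tw n q s x (V k) p p'

lemma psi_succ (n : ℕ) (q s x : ℂ) (h8 : 1 - s*x ≠ 0) (cap : Col n × Col n → ℂ) (V : ℕ → Vec n)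
    (k : ℕ) (a' b' : Col n) : psi n q s x cap V (k+1) (a', b') =
      uL n s x a' * ∑ b, psi n q s x cap V k (a', b) * MW n q s x 0 b (V k) b' +
      if a' = mid n then 0 else
        dL n s x a' * ∑ b, psi n q s x cap V k (mid n, b) * MW n q s x (eV n a') b (V k) b' := by
  rw [psi, Fintype.sum_prod_type]
  simp only [Tw_eq n q s x h8]
  by_cases ha : a' = mid n
  · subst ha
    rw [Finset.sum_eq_single (mid n)]
    · simp only [if_true, add_zero, Finset.mul_sum]
      refine Finset.sum_congr rfl fun b _ => by ring
    · intro a _ ha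
      refine Finset.sum_eq_zero fun b _ => ?_
      simp [ha, Ne.symm ha]
    · simp
  · have : ∀ a : Col n, (∑ b, psi n q s x cap V k (a, b) * (if a' = a then uL n s x a' *
        MW n q s x 0 b (V k) b' else if a = mid n then dL n s x a' * MW n q s x (eV n a') b (V k) b'
        else 0)) = (if a = a' then uL n s x a' * ∑ b, psi n q s x cap V k (a', b) *
          MW n q s x 0 b (V k) b' else 0) + (if a = mid n then dL n s x a' *
          ∑ b, psi n q s x cap V k (mid n, b) * MW n q s x (eV n a') b (V k) b' else 0) := by
      intro a
      by_cases h1 : a = a'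
      · subst h1
        simp only [if_true, ha, if_false, add_zero, Finset.mul_sum]
        refine Finset.sum_congr rfl fun b _ => by ring
      · by_cases h2 : a = mid n
        · subst h2
          simp only [if_true, ha, if_false, Finset.mul_sum, h1, zero_add]
          refine Finset.sum_congr rfl fun b _ => by ring
        · simp [h1, h2, Ne.symm h1]
    simp only [this, Finset.sum_add_distrib, Finset.sum_ite_eq', Finset.mem_univ, if_true, ha,
      if_false]

lemma sum_MW0_ne (n : ℕ) (q s x : ℂ) (h8 : 1 - s*x ≠ 0) (f : Col n → ℂ) (V : Vec n) (b' : Col n)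
    (hb : b' ≠ mid n) : ∑ b, f b * MW n q s x 0 b V b' = if V = 0 then vM n s x b' * f b' else 0 := by
  simp only [MW_zero n q s x h8, hb, if_false]
  rw [Finset.sum_eq_single b']
  · simp; split_ifs <;> ring
  · intro b _ h; simp [h]
  · simp

lemma sum_MW0_mid (n : ℕ) (q s x : ℂ) (h8 : 1 - s*x ≠ 0) (f : Col n → ℂ) (V : Vec n) :
    ∑ b, f b * MW n q s x 0 b V (mid n) = (if V = 0 then f (mid n) else 0) +
      ∑ b, if b ≠ mid n ∧ V = eV n b then ddM n s x b * f b else 0 := by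
  simp only [MW_zero n q s x h8, if_true]
  have : ∀ b : Col n, f b * (if b = mid n then (if V = 0 then vM n s x b else 0) else
      if V = eV n b then ddM n s x b else 0) = (if b = mid n then (if V = 0 then f (mid n) else 0)
       else 0) + (if b ≠ mid n ∧ V = eV n b then ddM n s x b * f b else 0) := by
    intro b
    by_cases hb : b = mid n
    · subst hb; simp [vM]
    · simp [hb, mul_comm]
  simp only [this, Finset.sum_add_distrib, Finset.sum_ite_eq', Finset.mem_univ, if_true]

/-- `cap` vanishes on `(0, b)` and `(c, 0)` for nonzero `b`, `c`. -/
def CapOK (n : ℕ) (cap : Col n × Col n → ℂ) : Prop :=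
  cap (mid n, mid n) = 1 ∧ (∀ b, b ≠ mid n → cap (mid n, b) = 0) ∧
    (∀ b, b ≠ mid n → cap (b, mid n) = 0)

open scoped Classical in
lemma psi_mid (n : ℕ) (q s x : ℂ) (h8 : 1 - s*x ≠ 0) (cap : Col n × Col n → ℂ)
    (hcap : CapOK n cap) (V : ℕ → Vec n) (k : ℕ) (b : Col n) :
    psi n q s x cap V k (mid n, b) = if b = mid n ∧ ∀ j < k, V j = 0 then 1 else 0 := by
  induction k generalizing b with
  | zero =>
    by_cases hb : b = mid n
    · subst hb; simp [psi, hcap.1]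
    · simp [psi, hb, hcap.2.1 b hb]
  | succ k ih =>
    rw [psi_succ n q s x h8]
    by_cases hb : b = mid n
    · subst hb
      rw [sum_MW0_mid n q s x h8]
      simp only [ih, Order.lt_add_one_iff, if_true, true_and, add_zero, uL, one_mul]
      rw [Finset.sum_eq_zero]
      · by_cases hV : V k = 0
        · simp only [hV, if_true, add_zero]
          congr 1
          apply propext
          constructor
          · intro h j hj
            rcases Nat.lt_or_eq_of_le hj with h1 | h1
            · exact h j h1
            · rw [h1, hV]
          · intro h j hj; exact h j hj.le
        · have : ¬ ∀ j ≤ k, V j = 0 := fun h => hV (h k le_rfl)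
          simp [hV, this]
      · intro b _
        by_cases hb : b = mid n <;> simp [hb]
    · rw [sum_MW0_ne n q s x h8 _ _ _ hb]
      simp [ih, hb]

lemma psi_succ' (n : ℕ) (q s x : ℂ) (h8 : 1 - s*x ≠ 0) (cap : Col n × Col n → ℂ)
    (hcap : CapOK n cap) (V : ℕ → Vec n)
    (k : ℕ) (a' b' : Col n) (ha : a' ≠ mid n) : psi n q s x cap V (k+1) (a', b') =
      uL n s x a' * ∑ b, psi n q s x cap V k (a', b) * MW n q s x 0 b (V k) b' +
        dL n s x a' * (psi n q s x cap V k (mid n, mid n) * MW n q s x (eV n a') (mid n) (V k) b') := by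
  rw [psi_succ n q s x h8, if_neg ha]
  congr 2
  apply Finset.sum_eq_single
  · intro b _ hb
    rw [psi_mid n q s x h8 cap hcap]; simp [hb]
  · simp

noncomputable def Pk (n : ℕ) (q s x : ℂ) (cap : Col n × Col n → ℂ) (k : ℕ) (c b : Col n) : ℂ :=
  (uL n s x c * vM n s x b)^k * cap (c, b) + if b = c then dL n s x c * pM n q s x c *
    ∑ j ∈ Finset.range k, (uL n s x c * vM n s x b)^j else 0

lemma Pk_succ (n : ℕ) (q s x : ℂ) (cap : Col n × Col n → ℂ) (k : ℕ) (c b : Col n) :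
    Pk n q s x cap (k+1) c b = uL n s x c * vM n s x b * Pk n q s x cap k c b +
      if b = c then dL n s x c * pM n q s x c else 0 := by
  unfold Pk
  rw [geom_sum_succ]
  split_ifs <;> ring

open scoped Classical in
lemma psi_eps (n : ℕ) (q s x : ℂ) (h8 : 1 - s*x ≠ 0) (cap : Col n × Col n → ℂ)
    (hcap : CapOK n cap) (V : ℕ → Vec n) (k : ℕ) (c b : Col n) (hc : c ≠ mid n) (hb : b ≠ mid n) :
    psi n q s x cap V k (c, b) = if ∀ j < k, V j = 0 then Pk n q s x cap k c b else 0 := by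
  induction k with
  | zero => simp [psi, Pk]
  | succ k ih =>
    rw [psi_succ' n q s x h8 cap hcap V k c b hc, sum_MW0_ne n q s x h8 _ _ _ hb, ih,
      psi_mid n q s x h8 cap hcap, MW_one n q s x c b hc]
    by_cases hV : V k = 0
    · have e : (∀ j < k+1, V j = 0) ↔ ∀ j < k, V j = 0 := by
        constructor
        · intro h j hj; exact h j (by omega)
        · intro h j hj
          rcases Nat.lt_or_eq_of_le (Nat.lt_succ_iff.1 hj) with h1 | h1
          · exact h j h1
          · rw [h1, hV]
      by_cases hall : ∀ j < k, V j = 0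
      · rw [if_pos (e.2 hall), Pk_succ]
        simp only [hV, if_true, if_pos hall, hb, if_false, true_and]
        split_ifs <;> ring
      · rw [if_neg (fun h => hall (e.1 h))]
        simp [hall]
    · have : ¬ ∀ j < k+1, V j = 0 := fun h => hV (h k (by omega))
      rw [if_neg this]
      simp [hV, hb]

open scoped Classical in
lemma psi_last (n : ℕ) (q s x : ℂ) (h8 : 1 - s*x ≠ 0) (cap : Col n × Col n → ℂ)
    (hcap : CapOK n cap) (V : ℕ → Vec n) (k : ℕ) (c : Col n) (hc : c ≠ mid n) :
    (V k = 0 → psi n q s x cap V (k+1) (c, mid n) = uL n s x c * psi n q s x cap V k (c, mid n)) ∧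
    (∀ b, b ≠ mid n → V k = eV n b → psi n q s x cap V (k+1) (c, mid n) =
      if ∀ j < k, V j = 0 then uL n s x c * (ddM n s x b * Pk n q s x cap k c b) +
        (if b = c then dL n s x c * stayM n q s x c else 0) else 0) ∧
    (V k ≠ 0 → (∀ b, b ≠ mid n → V k ≠ eV n b) → psi n q s x cap V (k+1) (c, mid n) = 0) := by
  rw [psi_succ' n q s x h8 cap hcap V k c _ hc, sum_MW0_mid n q s x h8, MW_one n q s x c _ hc,
    psi_mid n q s x h8 cap hcap]
  refine ⟨?_, ?_, ?_⟩
  · intro hV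
    have h0 := (eV_ne_zero n c hc).symm
    rw [Finset.sum_eq_zero]
    · simp [hV, h0]
    · intro b _
      rw [if_neg]
      rintro ⟨h1, h2⟩
      exact eV_ne_zero n b h1 (h2 ▸ hV)
  · intro b hb hV
    have hV0 : V k ≠ 0 := hV ▸ eV_ne_zero n b hb
    rw [Finset.sum_eq_single b]
    · have hp : b ≠ mid n ∧ V k = eV n b := ⟨hb, hV⟩
      rw [if_pos hp, if_neg hV0, psi_eps n q s x h8 cap hcap V k c b hc hb]
      have hbc : V k = eV n c ↔ b = c := by
        rw [hV]; exact ⟨eV_inj n b c hb, fun h => by rw [h]⟩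
      simp only [hbc, if_true, true_and]
      split_ifs <;> ring
    · intro b' _ hb'
      rw [if_neg]
      rintro ⟨h1, h2⟩
      exact hb' (eV_inj n b' b h1 (h2.symm.trans hV))
    · simp
  · intro hV h
    rw [Finset.sum_eq_zero]
    · simp [hV, h c hc]
    · intro b _
      rw [if_neg]
      rintro ⟨h1, h2⟩
      exact h b h1 h2

lemma geom_aux (al w e : ℂ) (k : ℕ) (h : w = e * (al^2-1)) :
    w * ∑ j ∈ Finset.range k, (al^2)^j = e * ((al^k)^2 - 1) := by
  have := mul_geom_sum (al^2) k
  rw [h, mul_assoc, this]; ring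

lemma al_sq (s x al : ℂ) (h8 : 1-s*x ≠ 0) (hal : al = (s-x)/(1-s*x)) :
    al^2 - 1 = -((1-s^2)*(1-x^2))/(1-s*x)^2 := by
  rw [hal, div_pow, eq_div_iff (pow_ne_zero 2 h8), sub_mul, div_mul_cancel₀ _ (pow_ne_zero 2 h8)]
  ring

lemma pow_aux (al : ℂ) (h : al ≠ 0) (k : ℕ) (u dd P d st s : ℂ) (hu : u = al * s⁻¹) :
    (al⁻¹)^(k+1) * (u * (dd * P) + d * st) =
      s⁻¹ * dd * ((al^k)⁻¹ * P) + al⁻¹ * (al^k)⁻¹ * d * st := by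
  subst hu
  have : al^k ≠ 0 := pow_ne_zero _ h
  rw [pow_succ, inv_pow]
  field_simp

lemma N_lolo (n : ℕ) (q s x : ℂ) (hs : s ≠ 0) (h6 : 1-x^2 ≠ 0) (h7 : s-x ≠ 0) (h8 : 1-s*x ≠ 0)
    (cap : Col n × Col n → ℂ) (k : ℕ) (c : Col n) (hc : c < mid n) (al : ℂ)
    (hal : al = (s-x)/(1-s*x)) :
    (al⁻¹)^(k+1) * (uL n s x c * (ddM n s x c * Pk n q s x cap k c c) + dL n s x c * stayM n q s x c)
    = s⁻¹ * ((1-s^2)/(1-s*x)) * (al^k * cap (c,c) + x^2*(1-q)/(1-x^2) * (al^k - (al^k)⁻¹))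
      + al⁻¹ * (al^k)⁻¹ * (x*(1-s^2)/(s*(1-s*x))) * ((1-s*x*q)/(1-s*x)) := by
  have hal0 : al ≠ 0 := by rw [hal]; exact div_ne_zero h7 h8
  have hk : al^k ≠ 0 := pow_ne_zero _ hal0
  rw [pow_aux al hal0 k (uL n s x c) _ _ _ _ s]
  · have hu : uL n s x c * vM n s x c = al^2 := by
      simp only [uL, vM, hc, hc.ne, if_true, if_false, hal]; field_simp
    have hw : dL n s x c * pM n q s x c = x^2*(1-q)/(1-x^2) * (al^2-1) := by
      rw [al_sq s x al h8 hal]; simp only [dL, pM, hc, if_true]; field_simp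
    simp only [Pk, hu, if_true]
    rw [geom_aux al _ _ k hw]
    simp only [ddM, dL, stayM, hc, if_true]
    field_simp
    ring
  · simp only [uL, hc, hc.ne, if_true, if_false, hal]; field_simp

lemma N_hihi (n : ℕ) (q s x : ℂ) (hq : q ≠ 0) (hs : s ≠ 0) (h6 : 1-x^2 ≠ 0) (h7 : s-x ≠ 0)
    (h8 : 1-s*x ≠ 0)
    (cap : Col n × Col n → ℂ) (k : ℕ) (c : Col n) (hc : mid n < c) (al : ℂ)
    (hal : al = (s-x)/(1-s*x)) :
    (s^2)⁻¹ * ((al⁻¹)^(k+1) *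
      (uL n s x c * (ddM n s x c * Pk n q s x cap k c c) + dL n s x c * stayM n q s x c))
    = s⁻¹ * (x*(s⁻¹-s)/(1-s*x)) * (al^k * cap (c,c) + q⁻¹*(1-q)/(1-x^2) * (al^k - (al^k)⁻¹))
      + (s^2)⁻¹ * al⁻¹ * (al^k)⁻¹ * ((1-s^2)/(1-s*x)) * ((q⁻¹-s*x)/(1-s*x)) := by
  have hal0 : al ≠ 0 := by rw [hal]; exact div_ne_zero h7 h8
  have hk : al^k ≠ 0 := pow_ne_zero _ hal0
  have hlt : ¬ c < mid n := hc.not_gt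
  rw [pow_aux al hal0 k (uL n s x c) _ _ _ _ s⁻¹]
  · have hu : uL n s x c * vM n s x c = al^2 := by
      simp only [uL, vM, hlt, hc.ne', if_false, hal]; field_simp
    have hw : dL n s x c * pM n q s x c = q⁻¹*(1-q)/(1-x^2) * (al^2-1) := by
      rw [al_sq s x al h8 hal]; simp only [dL, pM, hlt, if_false]; field_simp
    simp only [Pk, hu, if_true]
    rw [geom_aux al _ _ k hw]
    simp only [ddM, dL, stayM, hlt, if_false]
    field_simp
    ring
  · simp only [uL, hlt, hc.ne', if_false, hal]; field_simp

lemma N_lohi (n : ℕ) (q s x : ℂ) (hs : s ≠ 0) (h7 : s-x ≠ 0) (h8 : 1-s*x ≠ 0)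
    (cap : Col n × Col n → ℂ) (k : ℕ) (c b : Col n) (hc : c < mid n) (hb : mid n < b) (al : ℂ)
    (hal : al = (s-x)/(1-s*x)) :
    (al⁻¹)^(k+1) * (uL n s x c * (ddM n s x b * Pk n q s x cap k c b))
    = ((s^2)⁻¹)^k * (s⁻¹ * (x*(s⁻¹-s)/(1-s*x)) * (al^k * cap (c,b))) := by
  have hal0 : al ≠ 0 := by rw [hal]; exact div_ne_zero h7 h8
  have hk : al^k ≠ 0 := pow_ne_zero _ hal0
  have hlt : ¬ b < mid n := hb.not_gt
  have hbc : b ≠ c := (hc.trans hb).ne'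
  have h0 := pow_aux al hal0 k (uL n s x c) (ddM n s x b) (Pk n q s x cap k c b) 0 0 s
    (by simp only [uL, hc, hc.ne, if_true, if_false, hal]; field_simp)
  simp only [mul_zero, add_zero] at h0
  rw [h0]
  have hu : uL n s x c * vM n s x b = al^2 * (s^2)⁻¹ := by
    simp only [uL, vM, hlt, hb.ne', hc, hc.ne, if_true, if_false, hal]; field_simp
  simp only [Pk, hu, hbc, if_false, add_zero, ddM, hlt, mul_pow]
  field_simp
  ring

lemma N_hilo (n : ℕ) (q s x : ℂ) (hs : s ≠ 0) (h7 : s-x ≠ 0) (h8 : 1-s*x ≠ 0)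
    (cap : Col n × Col n → ℂ) (k : ℕ) (c b : Col n) (hc : mid n < c) (hb : b < mid n) (al : ℂ)
    (hal : al = (s-x)/(1-s*x)) :
    ((s^2)⁻¹)^(k+1) * ((al⁻¹)^(k+1) * (uL n s x c * (ddM n s x b * Pk n q s x cap k c b)))
    = s⁻¹ * ((1-s^2)/(1-s*x)) * (al^k * cap (c,b)) := by
  have hal0 : al ≠ 0 := by rw [hal]; exact div_ne_zero h7 h8
  have hk : al^k ≠ 0 := pow_ne_zero _ hal0
  have hlt : ¬ c < mid n := hc.not_gt
  have hbc : b ≠ c := (hb.trans hc).ne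
  have h0 := pow_aux al hal0 k (uL n s x c) (ddM n s x b) (Pk n q s x cap k c b) 0 0 s⁻¹
    (by simp only [uL, hlt, hc.ne', if_false, hal]; field_simp)
  simp only [mul_zero, add_zero] at h0
  rw [h0]
  have hu : uL n s x c * vM n s x b = al^2 * s^2 := by
    simp only [uL, vM, hlt, hb.ne, hb, hc.ne', if_true, if_false, hal]; field_simp
  simp only [Pk, hu, hbc, if_false, add_zero, ddM, hb, if_true, mul_pow, pow_succ ((s^2)⁻¹), inv_pow]
  have : (s^2)^k ≠ 0 := by positivity
  field_simp
  ring

noncomputable def capP (n : ℕ) (ν t qh x : ℂ) (p : Col n × Col n) : ℂ := capW n ν t qh x p.1 p.2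

lemma bar_bar (n : ℕ) (c : Col n) : barC n (barC n c) = c := by
  apply Fin.ext; have := c.isLt; simp only [barC]; omega

lemma mid_lt_bar (n : ℕ) (c : Col n) (hc : c < mid n) : mid n < barC n c := by
  rw [Fin.lt_def] at *; simp only [barC, mid] at *; omega

lemma capP_ok (n : ℕ) (ν t qh x : ℂ) : CapOK n (capP n ν t qh x) := by
  refine ⟨by simp [capP, capW], fun b hb => by simp [capP, capW, hb], fun b hb => ?_⟩
  have h1 : mid n ≠ barC n b := by
    intro h; apply hb; apply Fin.ext
    have := congrArg Fin.val h; simp only [mid, barC] at *; omega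
  simp [capP, capW, hb, h1, Ne.symm hb]

lemma capP_lo (n : ℕ) (ν t qh x : ℂ) (c : Col n) (hc : c < mid n) :
    capP n ν t qh x (c, c) = 1 - t * phiF ν t (qh * x⁻¹) ∧
    capP n ν t qh x (c, barC n c) = t * phiF ν t (qh * x⁻¹) ∧
    capP n ν t qh x (barC n c, c) = phiF ν t (qh * x⁻¹) ∧
    capP n ν t qh x (barC n c, barC n c) = 1 - phiF ν t (qh * x⁻¹) := by
  have hb := mid_lt_bar n c hc
  have h1 := (hc.trans hb).ne
  refine ⟨?_, ?_, ?_, ?_⟩ <;>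
  simp [capP, capW, hc, hc.ne, hc.not_gt, hb, hb.ne', hb.not_gt, h1, h1.symm, bar_bar]

lemma capP_other (n : ℕ) (ν t qh x : ℂ) (c b : Col n) (hc : c < mid n) (h1 : b ≠ c)
    (h2 : b ≠ barC n c) :
    capP n ν t qh x (c, b) = 0 ∧ capP n ν t qh x (barC n c, b) = 0 := by
  have hb := mid_lt_bar n c hc
  refine ⟨?_, ?_⟩ <;>
  simp [capP, capW, hc.ne, hb.ne', h1, h2, bar_bar]

lemma row_id (n : ℕ) (r s ν t x : ℂ) (hr : r ≠ 0) (hs : s ≠ 0) (hν : ν ≠ 0) (ht : t ≠ 0)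
    (hx : x ≠ 0) (h1 : r*x-ν*t ≠ 0) (h2 : ν*r*x+1 ≠ 0) (h3 : r-ν*t*x ≠ 0)
    (h4 : ν*r+x ≠ 0) (h5 : x^2-r^2 ≠ 0) (h6 : 1-x^2 ≠ 0) (h7 : s-x ≠ 0) (h8 : 1-s*x ≠ 0)
    (c : Col n) (hc : c < mid n) (V : ℕ → Vec n) (al : ℂ) (hal : al = (s-x)/(1-s*x)) (k : ℕ) :
    r^2 * ((s^2)⁻¹)^k * (al⁻¹)^k *
        psi n (r^2) s x (capP n ν t r⁻¹ x) V k (barC n c, mid n)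
      = ((r - ν * t * x) * (ν*r + x) / (ν * t * (1 - x ^ 2)))
          * (((1 - r^2 * x ^ 2) / (x ^ 2 - r^2)) * al^k *
              psi n (r^2) s x⁻¹ (capP n ν t r⁻¹ x⁻¹) V k (c, mid n)
            - (al⁻¹)^k * psi n (r^2) s x (capP n ν t r⁻¹ x) V k (c, mid n))
        + (al⁻¹)^k * psi n (r^2) s x (capP n ν t r⁻¹ x) V k (c, mid n) := by
  have hb := mid_lt_bar n c hc
  have hbl : ¬ barC n c < mid n := hb.not_gt
  have h7' : x - s ≠ 0 := by intro h; apply h7; linear_combination -h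
  have e8 : 1 - s * x⁻¹ = (x-s)/x := by field_simp
  have h8' : 1 - s * x⁻¹ ≠ 0 := by rw [e8]; exact div_ne_zero h7' hx
  have e7 : s - x⁻¹ = -(1-s*x)/x := by field_simp; ring
  have h7'' : s - x⁻¹ ≠ 0 := by rw [e7]; exact div_ne_zero (neg_ne_zero.2 h8) hx
  have e6 : 1 - x⁻¹^2 = -(1-x^2)/x^2 := by field_simp; ring
  have h6' : 1 - x⁻¹^2 ≠ 0 := by rw [e6]; exact div_ne_zero (neg_ne_zero.2 h6) (by positivity)
  have hal' : al⁻¹ = (s-x⁻¹)/(1-s*x⁻¹) := by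
    rw [e7, e8, hal, inv_div, div_div_div_cancel_right₀ hx, show x - s = -(s-x) by ring,
      neg_div_neg_eq]
  have hal0 : al ≠ 0 := by rw [hal]; exact div_ne_zero h7 h8
  have hr2 : r^2 ≠ 0 := by positivity
  induction k with
  | zero =>
    have o1 := (capP_ok n ν t r⁻¹ x).2.2
    have o2 := (capP_ok n ν t r⁻¹ x⁻¹).2.2
    simp [psi, o1 _ hb.ne', o1 _ hc.ne, o2 _ hc.ne]
  | succ k ih =>
    have p1 := psi_last n (r^2) s x h8 _ (capP_ok n ν t r⁻¹ x) V k c hc.ne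
    have p2 := psi_last n (r^2) s x h8 _ (capP_ok n ν t r⁻¹ x) V k (barC n c) hb.ne'
    have p3 := psi_last n (r^2) s x⁻¹ h8' _ (capP_ok n ν t r⁻¹ x⁻¹) V k c hc.ne
    by_cases hV : V k = 0
    · rw [p1.1 hV, p2.1 hV, p3.1 hV]
      have u1 : uL n s x c = al * s⁻¹ := by
        simp only [uL, hc, hc.ne, if_true, if_false, hal]; field_simp
      have u2 : uL n s x (barC n c) = al * s := by
        simp only [uL, hbl, hb.ne', if_false, hal]; field_simp
      have u3 : uL n s x⁻¹ c = al⁻¹ * s⁻¹ := by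
        simp only [uL, hc, hc.ne, if_true, if_false, hal']; field_simp
      rw [u1, u2, u3]
      have m1 : al⁻¹ * al = 1 := inv_mul_cancel₀ hal0
      have m2 : s⁻¹ * s = 1 := inv_mul_cancel₀ hs
      have g1 : ∀ Z : ℂ, (al⁻¹)^(k+1) * (al * s⁻¹ * Z) = s⁻¹ * ((al⁻¹)^k * Z) := by
        intro Z; rw [pow_succ]; linear_combination ((al⁻¹)^k * s⁻¹ * Z) * m1
      have g2 : ∀ Z : ℂ, r^2 * ((s^2)⁻¹)^(k+1) * (al⁻¹)^(k+1) * (al * s * Z)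
          = s⁻¹ * (r^2 * ((s^2)⁻¹)^k * (al⁻¹)^k * Z) := by
        intro Z
        rw [pow_succ, pow_succ, show (s^2)⁻¹ = s⁻¹ * s⁻¹ by field_simp]
        linear_combination (r^2 * (s⁻¹ * s⁻¹)^k * (al⁻¹)^k * s⁻¹ * Z) * (s⁻¹ * s * m1 + m2)
      have g3 : ∀ Z W : ℂ, W * al^(k+1) * (al⁻¹ * s⁻¹ * Z) = s⁻¹ * (W * al^k * Z) := by
        intro Z W; rw [pow_succ]; linear_combination (W * al^k * s⁻¹ * Z) * m1
      rw [g1, g2, g3, ih]; ring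
    · by_cases hV' : ∀ b, b ≠ mid n → V k ≠ eV n b
      · rw [p1.2.2 hV hV', p2.2.2 hV hV', p3.2.2 hV hV']; ring
      · push Not at hV'
        obtain ⟨b, hbm, hVb⟩ := hV'
        rw [p1.2.1 b hbm hVb, p2.2.1 b hbm hVb, p3.2.1 b hbm hVb]
        by_cases hall : ∀ j < k, V j = 0
        swap
        · simp only [if_neg hall]; ring
        simp only [if_pos hall]
        obtain ⟨c1, c2, c3, c4⟩ := capP_lo n ν t r⁻¹ x c hc
        obtain ⟨c1', c2', c3', c4'⟩ := capP_lo n ν t r⁻¹ x⁻¹ c hc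
        rw [phi_one r ν t x hr hν hx] at c1 c2 c3 c4
        rw [inv_inv, phi_two r ν t x hr hν] at c1' c2' c3' c4'
        have hak : al^k ≠ 0 := pow_ne_zero _ hal0
        by_cases hbc : b = c
        · subst hbc
          have hne : b ≠ barC n b := (hc.trans hb).ne
          simp only [if_true, if_neg hne, add_zero]
          have n1 := N_lolo n (r^2) s x hs h6 h7 h8 (capP n ν t r⁻¹ x) k b hc al hal
          have n2 := N_hilo n (r^2) s x hs h7 h8 (capP n ν t r⁻¹ x) k (barC n b) b hb hc al hal
          have n3 := N_lolo n (r^2) s x⁻¹ hs h6' h7'' h8' (capP n ν t r⁻¹ x⁻¹) k b hc al⁻¹ hal'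
          rw [c1] at n1
          rw [c3] at n2
          rw [c1', inv_inv, inv_pow, inv_inv] at n3
          have fin := alg_pos r s ν t x (al^k) hr hs hν ht hx hak h1 h2 h3 h4 h5 h6 h7 h8
          rw [mul_assoc (_ / _) (al^(k+1)), mul_assoc (r^2 * _), mul_assoc (r^2), n1, n2, n3]
          have hai : al⁻¹ = (1-s*x)/(s-x) := by rw [hal, inv_div]
          have q1 : (1 - s^2) / (1 - s*x⁻¹) = x*(1-s^2)/(x-s) := by
            rw [e8]; field_simp
          have q2 : x⁻¹^2*(1-r^2)/(1-x⁻¹^2) = -((1-r^2)/(1-x^2)) := by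
            rw [e6]; field_simp
          have q3 : x⁻¹*(1-s^2)/(s*(1-s*x⁻¹)) = (1-s^2)/(s*(x-s)) := by
            rw [e8]; field_simp
          have q4 : (1-s*x⁻¹*r^2)/(1-s*x⁻¹) = (x-s*r^2)/(x-s) := by
            rw [e8]; field_simp
          rw [q1, q2, q3, q4, hai]
          rw [← hal] at fin
          linear_combination fin
        · by_cases hbc2 : b = barC n c
          · subst hbc2
            simp only [if_true, if_neg hbc, add_zero]
            have n1 := N_lohi n (r^2) s x hs h7 h8 (capP n ν t r⁻¹ x) k c _ hc hb al hal
            have n2 := N_hihi n (r^2) s x hr2 hs h6 h7 h8 (capP n ν t r⁻¹ x) k _ hb al hal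
            have n3 := N_lohi n (r^2) s x⁻¹ hs h7'' h8' (capP n ν t r⁻¹ x⁻¹) k c _ hc hb al⁻¹ hal'
            rw [c2] at n1
            rw [c4] at n2
            rw [c2', inv_inv, inv_pow al k] at n3
            have fin := alg_neg r s ν t x (al^k) hr hs hν ht hx hak h1 h2 h3 h4 h5 h6 h7 h8
            have hai : al⁻¹ = (1-s*x)/(s-x) := by rw [hal, inv_div]
            have q1 : x⁻¹ * (s⁻¹ - s) / (1 - s*x⁻¹) = (s⁻¹-s)/(x-s) := by
              rw [e8]; field_simp
            rw [mul_assoc (_ / _) (al^(k+1)), n1, n3, q1, pow_succ ((s^2)⁻¹)]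
            rw [← hai] at fin
            linear_combination ((s^2)⁻¹)^k * fin + (r^2 * ((s^2)⁻¹)^k) * n2
          · obtain ⟨o1, o2⟩ := capP_other n ν t r⁻¹ x c b hc hbc hbc2
            obtain ⟨o3, o4⟩ := capP_other n ν t r⁻¹ x⁻¹ c b hc hbc hbc2
            simp only [Pk, o1, o2, o3, if_neg hbc, if_neg hbc2]; ring

lemma path_sum (n : ℕ) (q s x : ℂ) (cap : Col n × Col n → ℂ) (V : ℕ → Vec n) (k : ℕ)
    (z : Col n × Col n) :
    ∑ p : Fin (k+1) → Col n × Col n, (if p (Fin.last k) = z then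
      cap (p 0) * ∏ c : Fin k, Tw n q s x (V c) (p c.castSucc) (p c.succ) else 0)
    = psi n q s x cap V k z := by
  induction k generalizing z with
  | zero =>
    rw [psi, ← Equiv.sum_comp (Equiv.funUnique (Fin 1) (Col n × Col n)).symm]
    simp
  | succ k ih =>
    rw [psi, ← Equiv.sum_comp (Fin.snocEquiv (fun _ => Col n × Col n)), Fintype.sum_prod_type]
    simp only [← ih]
    rw [Finset.sum_eq_single z]
    · simp only [Finset.sum_mul]
      rw [Finset.sum_comm]
      refine Finset.sum_congr rfl fun p _ => ?_
      rw [if_pos (show (Fin.snocEquiv (fun _ => Col n × Col n)) (z, p) (Fin.last (k+1)) = z by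
        simp [Fin.snocEquiv])]
      simp only [Fin.snocEquiv, Equiv.coe_fn_mk]
      rw [Finset.sum_eq_single (p (Fin.last k))]
      · rw [if_pos rfl, Fin.prod_univ_castSucc]
        have h0 : (Fin.snoc p z : Fin (k+1+1) → Col n × Col n) 0 = p 0 := by
          have := Fin.snoc_castSucc (α := fun _ => Col n × Col n) z p 0
          simpa using this
        simp only [Fin.succ_last, Fin.snoc_last, Fin.snoc_castSucc, Fin.val_castSucc,
          Fin.val_last, h0, ← Fin.castSucc_succ]
        ring
      · intro b _ hb
        rw [if_neg (Ne.symm hb)]; simp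
      · simp
    · intro b _ hb
      refine Finset.sum_eq_zero fun p _ => ?_
      rw [if_neg]
      simpa [Fin.snocEquiv] using hb
    · simp

/-- Vertical edges determined by the horizontal ones, from the top down. -/
def vert (n L : ℕ) (μ : Fin n → ℤ) (H : ℕ → Fin (L+1) → Col n) : ℕ → Fin L → Vec n
  | 0 => fun c => topV n L μ c
  | r+1 => fun c k => if r % 2 = 0
      then vert n L μ H r c k + eV n (H r c.succ) k - eV n (H r c.castSucc) k
      else vert n L μ H r c k + eV n (H r c.castSucc) k - eV n (H r c.succ) k

lemma vert_congr (n L : ℕ) (μ : Fin n → ℤ) (H H' : ℕ → Fin (L+1) → Col n) (v : ℕ)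
    (h : ∀ r < v, H r = H' r) : vert n L μ H v = vert n L μ H' v := by
  induction v with
  | zero => rfl
  | succ v ih =>
    funext c k
    simp only [vert]
    rw [ih (fun r hr => h r (by omega)), h v (by omega)]

def extH (n L m : ℕ) (h : Fin m × Fin (L+1) → Col n) (r : ℕ) (p : Fin (L+1)) : Col n :=
  if hr : r < m then h (⟨r, hr⟩, p) else mid n

lemma extH_val (n L m : ℕ) (h : Fin m × Fin (L+1) → Col n) (r : Fin m) (p : Fin (L+1)) :
    h (r, p) = extH n L m h r p := by
  simp [extH]

def extx (n : ℕ) (x : Fin n → ℂ) (i : ℕ) : ℂ := if h : i < n then x ⟨i, h⟩ else 0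

def posN (n : ℕ) (i : ℕ) : Col n := if h : i < n then posC n ⟨i, h⟩ else mid n

def leftC (n : ℕ) (σ : Equiv.Perm (Col n)) (r : ℕ) : Col n :=
  if r % 2 = 0 then mid n else σ (posN n (r/2))

def Phi (n L : ℕ) (μ : Fin n → ℤ) (h : Fin (2*n) × Fin (L+1) → Col n) : St n L :=
  (h, fun vc => vert n L μ (extH n L (2*n) h) vc.1 vc.2)

noncomputable def rowW (n L : ℕ) (q s : ℂ) (μ : Fin n → ℤ) (xe : ℕ → ℂ)
    (H : ℕ → Fin (L+1) → Col n) (r : ℕ) : ℂ :=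
  ∏ c : Fin L, if r % 2 = 0 then
      MW n q s (xe (r/2)) (vert n L μ H (r+1) c) (H r c.castSucc) (vert n L μ H r c) (H r c.succ)
    else
      LW n q s (xe (r/2)) (vert n L μ H (r+1) c) (H r c.succ) (vert n L μ H r c) (H r c.castSucc)

noncomputable def capN (n L : ℕ) (ν t qh : ℂ) (xe : ℕ → ℂ)
    (H : ℕ → Fin (L+1) → Col n) (i : ℕ) : ℂ :=
  capW n ν t qh (xe i) (H (2*i+1) 0) (H (2*i) 0)

lemma stWt_Phi (n L : ℕ) (q s ν t qh : ℂ) (x : Fin n → ℂ) (μ : Fin n → ℤ)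
    (h : Fin (2*n) × Fin (L+1) → Col n) :
    stWt n L q s ν t qh x (Phi n L μ h) =
      (∏ r ∈ Finset.range (2*n), rowW n L q s μ (extx n x) (extH n L (2*n) h) r) *
        ∏ i ∈ Finset.range n, capN n L ν t qh (extx n x) (extH n L (2*n) h) i := by
  unfold stWt
  rw [Finset.prod_range, Finset.prod_range]
  have hx : ∀ (i : ℕ) (hi : i < n), x ⟨i, hi⟩ = extx n x i := by
    intro i hi; simp [extx, hi]
  congr 1
  · refine Finset.prod_congr rfl fun r _ => ?_
    unfold rowW
    refine Finset.prod_congr rfl fun c _ => ?_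
    simp only [Phi, extH_val, hx, Fin.val_succ, Fin.val_castSucc]
  · refine Finset.prod_congr rfl fun i _ => ?_
    simp only [capN, Phi, extH_val]
    rw [← hx i i.isLt]

lemma BC_Phi (n L : ℕ) (σ : Equiv.Perm (Col n)) (μ : Fin n → ℤ)
    (h : Fin (2*n) × Fin (L+1) → Col n) :
    BC n L σ μ (Phi n L μ h) ↔
      (∀ r < 2*n, extH n L (2*n) h r (Fin.last L) = leftC n σ r) ∧
      ∀ c, vert n L μ (extH n L (2*n) h) (2*n) c = 0 := by
  unfold BC
  constructor
  · rintro ⟨h1, -, h3⟩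
    refine ⟨fun r hr => ?_, fun c => ?_⟩
    · have := h1 ⟨r, hr⟩
      simp only [Phi, extH_val] at this
      rw [this, leftC, posN, dif_pos (show r/2 < n by omega)]
    · exact h3 c
  · rintro ⟨h1, h3⟩
    refine ⟨fun r => ?_, fun c => rfl, fun c => h3 c⟩
    have := h1 r r.isLt
    simp only [Phi, extH_val]
    rw [this, leftC, posN, dif_pos (show (r : ℕ)/2 < n by have := r.isLt; omega)]

lemma eq_Phi (n L : ℕ) (q s ν t qh : ℂ) (x : Fin n → ℂ) (μ : Fin n → ℤ)
    (σ : Equiv.Perm (Col n)) (st : St n L) (hB : BC n L σ μ st)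
    (hw : stWt n L q s ν t qh x st ≠ 0) : Phi n L μ st.1 = st := by
  refine Prod.ext rfl ?_
  have key : ∀ v : ℕ, ∀ hv : v < 2*n+1, ∀ c, vert n L μ (extH n L (2*n) st.1) v c = st.2 (⟨v, hv⟩, c) := by
    intro v
    induction v with
    | zero => intro hv c; exact (hB.2.1 c).symm
    | succ v ih =>
      intro hv c
      have hv' : v < 2*n := by omega
      have hne := Finset.prod_ne_zero_iff.1 (left_ne_zero_of_mul hw) ⟨v, hv'⟩ (Finset.mem_univ _)
      have hne := Finset.prod_ne_zero_iff.1 hne c (Finset.mem_univ _)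
      funext k
      simp only [vert, ih (by omega) c]
      have e1 : ∀ p, extH n L (2*n) st.1 v p = st.1 (⟨v, hv'⟩, p) := fun p => by simp [extH, hv']
      rw [e1, e1]
      split_ifs with hpar
      · rw [if_pos hpar] at hne
        have := MW_cons _ _ _ _ _ _ _ _ hne k
        simp only [Fin.succ_mk, Fin.castSucc_mk] at this
        omega
      · rw [if_neg hpar] at hne
        have := LW_cons _ _ _ _ _ _ _ _ hne k
        simp only [Fin.succ_mk, Fin.castSucc_mk] at this
        omega
  funext vc
  exact key vc.1 vc.1.isLt vc.2

open scoped Classical in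
lemma pf_eq (n L : ℕ) (q s ν t qh : ℂ) (x : Fin n → ℂ) (μ : Fin n → ℤ)
    (σ : Equiv.Perm (Col n)) : pf n L q s ν t qh x σ μ =
      ∑ h : Fin (2*n) × Fin (L+1) → Col n, if BC n L σ μ (Phi n L μ h) then
        stWt n L q s ν t qh x (Phi n L μ h) else 0 := by
  unfold pf
  have hinj : Function.Injective (Phi n L μ) := fun a b hab => congrArg Prod.fst hab
  rw [finsum_mem_def, finsum_eq_sum_of_support_subset (s := Finset.univ.image (Phi n L μ)),
    Finset.sum_image (fun a _ b _ hab => hinj hab)]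
  · refine Finset.sum_congr rfl fun h _ => ?_
    simp [Set.indicator_apply]
  · intro st hst
    rw [Function.mem_support, Set.indicator_apply_ne_zero] at hst
    simp only [Finset.coe_image, Finset.coe_univ, Set.image_univ, Set.mem_range]
    exact ⟨st.1, eq_Phi n L q s ν t qh x μ σ st hst.1 hst.2⟩

/-- Splitting off the two bottom rows. -/
def splitE (N L : ℕ) : ((Fin (2*N) × Fin (L+1) → Col (N+1)) × (Fin (L+1) → Col (N+1) × Col (N+1))) ≃
    (Fin (2*(N+1)) × Fin (L+1) → Col (N+1)) where
  toFun f := fun rp => if hr : rp.1.val < 2*N then f.1 (⟨rp.1.val, hr⟩, rp.2) else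
    if rp.1.val = 2*N then (f.2 rp.2).2 else (f.2 rp.2).1
  invFun h := (fun rp => h (⟨rp.1.val, by have := rp.1.isLt; omega⟩, rp.2),
    fun p => (h (⟨2*N+1, by omega⟩, p), h (⟨2*N, by omega⟩, p)))
  left_inv f := by
    refine Prod.ext ?_ ?_
    · funext rp; simp
    · funext p; simp
  right_inv h := by
    funext ⟨⟨r, hr⟩, p⟩
    by_cases h1 : r < 2*N
    · simp [h1]
    · by_cases h2 : r = 2*N
      · subst h2; simp
      · have : r = 2*N+1 := by omega
        subst this; simp

open scoped Classical in
noncomputable def Gup (N L : ℕ) (q s ν t qh : ℂ) (μ : Fin (N+1) → ℤ) (xe : ℕ → ℂ) (lc : ℕ → Col (N+1))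
    (H : ℕ → Fin (L+1) → Col (N+1)) : ℂ :=
  if ∀ r < 2*N, H r (Fin.last L) = lc r then
    (∏ r ∈ Finset.range (2*N), rowW (N+1) L q s μ xe H r) *
      ∏ i ∈ Finset.range N, capN (N+1) L ν t qh xe H i else 0

lemma Gup_congr (N L : ℕ) (q s ν t qh : ℂ) (μ : Fin (N+1) → ℤ) (xe xe' : ℕ → ℂ)
    (lc lc' : ℕ → Col (N+1)) (H H' : ℕ → Fin (L+1) → Col (N+1))
    (hx : ∀ i < N, xe i = xe' i) (hl : ∀ r < 2*N, lc r = lc' r) (hH : ∀ r < 2*N, H r = H' r) :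
    Gup N L q s ν t qh μ xe lc H = Gup N L q s ν t qh μ xe' lc' H' := by
  unfold Gup
  have e1 : (∀ r < 2*N, H r (Fin.last L) = lc r) ↔ (∀ r < 2*N, H' r (Fin.last L) = lc' r) :=
    forall₂_congr fun r hr => by rw [hH r hr, hl r hr]
  have e2 : (∏ r ∈ Finset.range (2*N), rowW (N+1) L q s μ xe H r) =
      ∏ r ∈ Finset.range (2*N), rowW (N+1) L q s μ xe' H' r := by
    refine Finset.prod_congr rfl fun r hr => ?_
    rw [Finset.mem_range] at hr
    unfold rowW
    rw [hx (r/2) (by omega), hH r hr, vert_congr _ L μ H H' r (fun i hi => hH i (by omega)),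
      vert_congr _ L μ H H' (r+1) (fun i hi => hH i (by omega))]
  have e3 : (∏ i ∈ Finset.range N, capN (N+1) L ν t qh xe H i) =
      ∏ i ∈ Finset.range N, capN (N+1) L ν t qh xe' H' i := by
    refine Finset.prod_congr rfl fun i hi => ?_
    rw [Finset.mem_range] at hi
    unfold capN
    rw [hx i hi, hH (2*i+1) (by omega), hH (2*i) (by omega)]
  simp only [e1, e2, e3]

open scoped Classical in
lemma factor (N L : ℕ) (q s ν t qh : ℂ) (x : Fin (N+1) → ℂ) (μ : Fin (N+1) → ℤ)
    (σ : Equiv.Perm (Col (N+1))) (h' : Fin (2*N) × Fin (L+1) → Col (N+1))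
    (ab : Fin (L+1) → Col (N+1) × Col (N+1)) :
    (if BC (N+1) L σ μ (Phi (N+1) L μ (splitE N L (h', ab))) then
        stWt (N+1) L q s ν t qh x (Phi (N+1) L μ (splitE N L (h', ab))) else 0)
    = Gup N L q s ν t qh μ (extx (N+1) x) (leftC (N+1) σ) (extH (N+1) L (2*N) h') *
      (if ab (Fin.last L) = (σ (posN (N+1) N), mid (N+1)) then
        capP (N+1) ν t qh (extx (N+1) x N) (ab 0) * ∏ c : Fin L, Tw (N+1) q s (extx (N+1) x N)
          (vert (N+1) L μ (extH (N+1) L (2*N) h') (2*N) c) (ab c.castSucc) (ab c.succ) else 0) := by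
  rw [BC_Phi, stWt_Phi]
  have hup : ∀ r < 2*N, extH (N+1) L (2*(N+1)) (splitE N L (h', ab)) r = extH (N+1) L (2*N) h' r := by
    intro r hr
    funext p
    simp [extH, splitE, hr, show r < 2*(N+1) by omega]
  have hb : ∀ p, extH (N+1) L (2*(N+1)) (splitE N L (h', ab)) (2*N) p = (ab p).2 := by
    intro p
    simp [extH, splitE]
  have ha : ∀ p, extH (N+1) L (2*(N+1)) (splitE N L (h', ab)) (2*N+1) p = (ab p).1 := by
    intro p
    simp [extH, splitE, show 2*N+1 < 2*(N+1) by omega]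
  rw [← Gup_congr N L q s ν t qh μ (extx (N+1) x) _ (leftC (N+1) σ) _ _ _ (fun _ _ => rfl)
    (fun _ _ => rfl) hup, ← vert_congr (N+1) L μ _ _ (2*N) hup]
  generalize extH (N+1) L (2*(N+1)) (splitE N L (h', ab)) = H at *
  have hB : (∀ r < 2*(N+1), H r (Fin.last L) = leftC (N+1) σ r) ↔
      (∀ r < 2*N, H r (Fin.last L) = leftC (N+1) σ r) ∧
        ab (Fin.last L) = (σ (posN (N+1) N), mid (N+1)) := by
    have l1 : leftC (N+1) σ (2*N) = mid (N+1) := by simp [leftC]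
    have l2 : leftC (N+1) σ (2*N+1) = σ (posN (N+1) N) := by
      rw [leftC, if_neg (by omega), show (2*N+1)/2 = N by omega]
    constructor
    · intro h
      refine ⟨fun r hr => h r (by omega), Prod.ext ?_ ?_⟩
      · rw [← ha, h _ (by omega), l2]
      · rw [← hb, h _ (by omega), l1]
    · rintro ⟨h1, h2⟩ r hr
      by_cases hr1 : r < 2*N
      · exact h1 r hr1
      · by_cases hr2 : r = 2*N
        · rw [hr2, hb, h2, l1]
        · have : r = 2*N+1 := by omega
          rw [this, ha, h2, l2]
  have hw : ∀ c, vert (N+1) L μ H (2*N+1) c = fun k => vert (N+1) L μ H (2*N) c k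
      + eV (N+1) (ab c.succ).2 k - eV (N+1) (ab c.castSucc).2 k := by
    intro c; funext k
    rw [vert]; beta_reduce; rw [if_pos (by omega), hb, hb]
  have hz : ∀ c k, vert (N+1) L μ H (2*(N+1)) c k = vert (N+1) L μ H (2*N+1) c k
      + eV (N+1) (ab c.castSucc).1 k - eV (N+1) (ab c.succ).1 k := by
    intro c k
    rw [show 2*(N+1) = 2*N+1+1 by ring, vert]; beta_reduce; rw [if_neg (by omega), ha, ha]
  unfold Gup
  rw [hB]
  by_cases h1 : ∀ r < 2*N, H r (Fin.last L) = leftC (N+1) σ r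
  swap
  · simp [h1]
  by_cases h2 : ab (Fin.last L) = (σ (posN (N+1) N), mid (N+1))
  swap
  · simp [h2]
  rw [if_pos h1, if_pos h2]
  by_cases h3 : ∀ c, vert (N+1) L μ H (2*(N+1)) c = 0
  · rw [if_pos ⟨⟨h1, h2⟩, h3⟩, show 2*(N+1) = 2*N+1+1 by ring, Finset.prod_range_succ,
      Finset.prod_range_succ, Finset.prod_range_succ]
    have e1 : rowW (N+1) L q s μ (extx (N+1) x) H (2*N) * rowW (N+1) L q s μ (extx (N+1) x) H (2*N+1)
        = ∏ c : Fin L, Tw (N+1) q s (extx (N+1) x N)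
          (vert (N+1) L μ H (2*N) c) (ab c.castSucc) (ab c.succ) := by
      unfold rowW
      rw [← Finset.prod_mul_distrib]
      refine Finset.prod_congr rfl fun c _ => ?_
      rw [if_pos (by omega), if_neg (by omega), show (2*N+1)/2 = N by omega,
        show 2*N/2 = N by omega, show 2*N+1+1 = 2*(N+1) by ring, h3 c, ha, ha, hb, hb, hw, mul_comm]
      rfl
    have e2 : capN (N+1) L ν t qh (extx (N+1) x) H N = capP (N+1) ν t qh (extx (N+1) x N) (ab 0) := by
      rw [capN, capP, ha, hb]
    rw [← e1, ← e2]; ring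
  · rw [if_neg (fun h => h3 h.2)]
    push Not at h3
    obtain ⟨c, hc⟩ := h3
    rw [Finset.prod_eq_zero (Finset.mem_univ c)]
    · simp
    · unfold Tw
      rw [← hw]
      by_contra hne
      have := LW_cons _ _ _ _ _ _ _ _ (left_ne_zero_of_mul hne)
      apply hc
      funext k
      have h4 := this k
      rw [hz]
      simp only [Pi.zero_apply] at *
      omega

noncomputable def Vof (n L : ℕ) (W : Fin L → Vec n) (c : ℕ) : Vec n :=
  if h : c < L then W ⟨c, h⟩ else 0

lemma pf_final (N L : ℕ) (q s ν t qh : ℂ) (x : Fin (N+1) → ℂ) (μ : Fin (N+1) → ℤ)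
    (σ : Equiv.Perm (Col (N+1))) : pf (N+1) L q s ν t qh x σ μ =
      ∑ h' : Fin (2*N) × Fin (L+1) → Col (N+1),
        Gup N L q s ν t qh μ (extx (N+1) x) (leftC (N+1) σ) (extH (N+1) L (2*N) h') *
        psi (N+1) q s (extx (N+1) x N) (capP (N+1) ν t qh (extx (N+1) x N))
          (Vof (N+1) L (vert (N+1) L μ (extH (N+1) L (2*N) h') (2*N))) L
          (σ (posN (N+1) N), mid (N+1)) := by
  classical
  rw [pf_eq, ← Equiv.sum_comp (splitE N L), Fintype.sum_prod_type]
  refine Finset.sum_congr rfl fun h' _ => ?_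
  rw [← path_sum, Finset.mul_sum]
  refine Finset.sum_congr rfl fun ab _ => ?_
  rw [factor]
  have : ∀ c : Fin L, Vof (N+1) L (vert (N+1) L μ (extH (N+1) L (2*N) h') (2*N)) c =
    vert (N+1) L μ (extH (N+1) L (2*N) h') (2*N) c := fun c => by simp [Vof]
  simp only [this]
/-- Theorem 3.3: recursion for the partition function at the
reflection `s_n`, assuming `σ(n) ∈ [n]`.  Here `nn` is the 0-indexed last
position (the paper's `n`), `qh` is the fixed branch of `q^{-1/2}` and
`qh⁻¹ = √q`. -/
theorem partition_function_recursion_sn (n L : ℕ) (hn : 0 < n) (hL : 0 < L)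
    (q s ν t qh : ℂ) (x : Fin n → ℂ)
    (hq : q ≠ 0) (hs : s ≠ 0) (hν : ν ≠ 0) (ht : t ≠ 0) (hqh : qh ^ 2 * q = 1)
    (hx0 : ∀ j, x j ≠ 0) (hsx : ∀ j, 1 - s * x j ≠ 0)
    (hc1 : ∀ j, 1 - ν * t * (qh * (x j)⁻¹) ≠ 0)
    (hc2 : ∀ j, 1 + ν⁻¹ * (qh * (x j)⁻¹) ≠ 0)
    (σ : Equiv.Perm (Col n)) (hσ : ∀ k, σ (barC n k) = barC n (σ k))
    (μ : Fin n → ℤ) (hμ : ∀ j, 1 ≤ |μ j| ∧ |μ j| ≤ (L : ℤ))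
    (nn : Fin n) (hnn : (nn : ℕ) = n - 1)
    (hσn : σ (posC n nn) < mid n)
    (hden1 : s - x nn ≠ 0) (hden2 : (x nn) ^ 2 - q ≠ 0)
    (hden3 : 1 - (x nn) ^ 2 ≠ 0) (hden4 : 1 - s * (x nn)⁻¹ ≠ 0)
    (hden5 : 1 - ν * t * (qh * x nn) ≠ 0) (hden6 : 1 + ν⁻¹ * (qh * x nn) ≠ 0) :
    q * s ^ (-(2 * (L : ℤ))) * ((1 - s * x nn) / (s - x nn)) ^ L
        * pf n L q s ν t qh x ((snB n).trans σ) μ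
      = ((qh⁻¹ - ν * t * x nn) * (qh⁻¹ + ν⁻¹ * x nn) / (t * (1 - (x nn) ^ 2)))
          * (((1 - q * (x nn) ^ 2) / ((x nn) ^ 2 - q))
              * ((s - x nn) / (1 - s * x nn)) ^ L
              * pf n L q s ν t qh (Function.update x nn (x nn)⁻¹) σ μ
            - ((1 - s * x nn) / (s - x nn)) ^ L * pf n L q s ν t qh x σ μ)
        + ((1 - s * x nn) / (s - x nn)) ^ L * pf n L q s ν t qh x σ μ := by
  obtain ⟨N, rfl⟩ : ∃ N, n = N+1 := ⟨n-1, by omega⟩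
  obtain rfl : nn = Fin.last N := by apply Fin.ext; simpa using hnn
  have hqh0 : qh ≠ 0 := by rintro rfl; simp at hqh
  obtain ⟨r, rfl⟩ : ∃ r, qh = r⁻¹ := ⟨qh⁻¹, (inv_inv qh).symm⟩
  have hr : r ≠ 0 := by simpa using hqh0
  obtain rfl : q = r^2 := by
    have : r^2 * ((r⁻¹)^2 * q) = r^2 * 1 := by rw [hqh]
    rw [← mul_assoc, ← mul_pow, mul_inv_cancel₀ hr] at this
    simpa using this
  rw [pf_final, pf_final, pf_final]
  have hlast : posN (N+1) N = posC (N+1) (Fin.last N) := by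
    simp [posN, Fin.last]
  have hxN : extx (N+1) x N = x (Fin.last N) := by simp [extx, Fin.last]
  have hxN' : extx (N+1) (Function.update x (Fin.last N) (x (Fin.last N))⁻¹) N
      = (x (Fin.last N))⁻¹ := by
    simp only [extx, Nat.lt_succ_self, dif_pos]
    exact Function.update_self (Fin.last N) _ x
  have hlc : lastCol (N+1) = posC (N+1) (Fin.last N) := by
    apply Fin.ext; simp [lastCol, posC]
  have hsn : ((snB (N+1)).trans σ) (posN (N+1) N) = barC (N+1) (σ (posN (N+1) N)) := by
    rw [hlast, ← hσ]
    simp [snB, hlc]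
  have hG1 : ∀ H, Gup N L (r^2) s ν t r⁻¹ μ (extx (N+1) x) (leftC (N+1) ((snB (N+1)).trans σ)) H =
      Gup N L (r^2) s ν t r⁻¹ μ (extx (N+1) x) (leftC (N+1) σ) H := by
    intro H
    refine Gup_congr N L _ s ν t _ μ _ _ _ _ _ _ (fun _ _ => rfl) (fun i hi => ?_) (fun _ _ => rfl)
    unfold leftC
    have hi2 : i / 2 < N := by omega
    have e : snB (N+1) (posN (N+1) (i/2)) = posN (N+1) (i/2) := by
      rw [posN, dif_pos (by omega), snB]
      apply Equiv.swap_apply_of_ne_of_ne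
      · intro h; have := congrArg Fin.val h; simp only [posC, lastCol] at this; omega
      · intro h; have := congrArg Fin.val h; simp only [posC, lastCol, barC] at this; omega
    rw [Equiv.trans_apply, e]
  have hG2 : ∀ H, Gup N L (r^2) s ν t r⁻¹ μ
      (extx (N+1) (Function.update x (Fin.last N) (x (Fin.last N))⁻¹)) (leftC (N+1) σ) H =
      Gup N L (r^2) s ν t r⁻¹ μ (extx (N+1) x) (leftC (N+1) σ) H := by
    intro H
    refine Gup_congr N L _ s ν t _ μ _ _ _ _ _ _ (fun i hi => ?_) (fun i hi => rfl) (fun _ _ => rfl)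
    unfold extx
    rw [dif_pos (by omega), dif_pos (by omega), Function.update_of_ne]
    intro h; have := congrArg Fin.val h; simp at this; omega
  simp only [hG1, hG2, hsn, hxN, hxN']
  rw [← hlast] at hσn
  have hx := hx0 (Fin.last N)
  have h8 := hsx (Fin.last N)
  have hc1 := hc1 (Fin.last N)
  have hc2 := hc2 (Fin.last N)
  generalize x (Fin.last N) = y at *
  have h1 : r*y-ν*t ≠ 0 := by
    intro h; apply hc1; field_simp; linear_combination h
  have h2 : ν*r*y+1 ≠ 0 := by
    intro h; apply hc2; field_simp; linear_combination h
  have h3 : r-ν*t*y ≠ 0 := by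
    intro h; apply hden5; field_simp; linear_combination h
  have h4 : ν*r+y ≠ 0 := by
    intro h; apply hden6; field_simp; linear_combination h
  have key := fun V => row_id (N+1) r s ν t y hr hs hν ht hx h1 h2 h3 h4 hden2 hden3 hden1 h8
    (σ (posN (N+1) N)) hσn V ((s-y)/(1-s*y)) rfl L
  have hpref : (r⁻¹⁻¹ - ν * t * y) * (r⁻¹⁻¹ + ν⁻¹ * y) / (t * (1 - y^2)) =
      (r - ν * t * y) * (ν*r + y) / (ν * t * (1 - y ^ 2)) := by
    rw [inv_inv]; field_simp
  have hspow : s ^ (-(2 * (L : ℤ))) = ((s^2)⁻¹)^L := by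
    rw [zpow_neg, zpow_mul, inv_pow]; norm_cast
  rw [hpref, hspow, ← inv_div (s-y) (1-s*y)]
  simp only [Finset.mul_sum]
  rw [← Finset.sum_sub_distrib, Finset.mul_sum, ← Finset.sum_add_distrib]
  refine Finset.sum_congr rfl fun h' _ => ?_
  linear_combination (Gup N L (r^2) s ν t r⁻¹ μ (extx (N+1) x) (leftC (N+1) σ)
    (extH (N+1) L (2*N) h')) * key (Vof (N+1) L (vert (N+1) L μ (extH (N+1) L (2*N) h') (2*N)))
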